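/- If every graph with no K_t-minor has fractional chromatic number at most 2t-2, then every signed graph (G, σ) with no K̃_t-minor has fractional balanced chromatic number at most 2t-2. -/

import Mathlib

/-- A signed (multi)graph: an edge set with endpoints (an unordered pair,
possibly a loop) and a sign for each edge (`neg e = true` means `e` is negative). -/
structure SGraph (V : Type) where
  E : Type
  ends : E → Sym2 V
  neg : E → Bool

namespace SGraph

variable {V W : Type}

/-- Walks in a signed multigraph, recorded as sequences of edges. -/
inductive Walk (G : SGraph V) : V → V → Type where
  | nil {v : V} : Walk G v v
  | cons {u v w : V} (e : G.E) (h : G.ends e = s(u, v)) (p : Walk G v w) : Walk G u w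

namespace Walk

variable {G : SGraph V}

/-- The list of edges of a walk. -/
def edges : {u v : V} → G.Walk u v → List G.E
  | _, _, .nil => []
  | _, _, .cons e _ p => e :: p.edges

/-- The list of vertices visited by a walk (in order, with repetitions). -/
def support : {u v : V} → G.Walk u v → List V
  | u, _, .nil => [u]
  | u, _, .cons _ _ p => u :: p.support

/-- A walk is negative if it uses an odd number of negative edges
(its sign, the product of the signs of its edges with multiplicity, is `-1`). -/
def isNeg {u v : V} (p : G.Walk u v) : Bool :=
  (p.edges.map G.neg).foldr Bool.xor false

/-- A closed walk is a cycle if it has at least one edge, no repeated edge,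
and no repeated vertex (except the initial vertex which is also final). -/
def IsCycle {v : V} (p : G.Walk v v) : Prop :=
  p.edges ≠ [] ∧ p.edges.Nodup ∧ p.support.tail.Nodup

/-- The internal vertices of a walk. -/
def inner {u v : V} (p : G.Walk u v) : List V :=
  p.support.tail.dropLast

end Walk

/-- A set of vertices is balanced if it induces no negative cycle. -/
def BalancedSet (G : SGraph V) (X : Set V) : Prop :=
  ∀ (v : V) (p : G.Walk v v), p.IsCycle → (∀ u ∈ p.support, u ∈ X) → p.isNeg = false

/-- A signed graph is balanced if it contains no negative cycle. -/
def IsBalanced (G : SGraph V) : Prop := G.BalancedSet Set.univ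

/-- The signed graph has a negative loop. -/
def HasNegLoop (G : SGraph V) : Prop :=
  ∃ e : G.E, (∃ v : V, G.ends e = s(v, v)) ∧ G.neg e = true

/-- The signed graph has a positive loop. -/
def HasPosLoop (G : SGraph V) : Prop :=
  ∃ e : G.E, (∃ v : V, G.ends e = s(v, v)) ∧ G.neg e = false

/-- A balanced `k`-coloring: a partition of the vertices into `k` balanced color classes. -/
def ColorableB (G : SGraph V) (k : ℕ) : Prop :=
  ∃ c : V → Fin k, ∀ i : Fin k, G.BalancedSet {v | c v = i}

/-- The balanced chromatic number. -/
noncomputable def chromNumB (G : SGraph V) : ℕ∞ :=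
  ⨅ n ∈ {n : ℕ | G.ColorableB n}, (n : ℕ∞)

/-- Switching at the set of vertices where `s` is `true`: the sign of an edge is
multiplied by `-1` once for each of its endpoints (with multiplicity) in the set;
thus an edge with exactly one endpoint in the set changes sign, and loops are unchanged. -/
def switch (G : SGraph V) (s : V → Bool) : SGraph V where
  E := G.E
  ends := G.ends
  neg e := Bool.xor (G.neg e)
    (Sym2.lift ⟨fun u v => Bool.xor (s u) (s v), fun u v => Bool.xor_comm _ _⟩ (G.ends e))

/-- The negation of a signature. -/
def negate (G : SGraph V) : SGraph V where
  E := G.E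
  ends := G.ends
  neg e := !(G.neg e)

/-- A set of vertices is connected via positive edges inside itself. -/
def PosConnected (G : SGraph V) (B : Set V) : Prop :=
  B.Nonempty ∧ ∀ u ∈ B, ∀ v ∈ B, ∃ p : G.Walk u v,
    (∀ x ∈ p.support, x ∈ B) ∧ ∀ e ∈ p.edges, G.neg e = false

/-- `H` is a minor of `G`: after a suitable switching of `G`, there are disjoint
branch sets (each connected via positive edges) for the vertices of `H`, and
distinct edges of `G`, with the correct signs, realizing the edges of `H`. -/
def IsMinor (H : SGraph W) (G : SGraph V) : Prop :=
  ∃ s : V → Bool, ∃ B : W → Set V,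
    (∀ x : W, (G.switch s).PosConnected (B x)) ∧
    (Pairwise fun x y => Disjoint (B x) (B y)) ∧
    ∃ η : H.E → G.E, Function.Injective η ∧
      ∀ (e : H.E) (x y : W), H.ends e = s(x, y) →
        (G.switch s).neg (η e) = H.neg e ∧
        ∃ u v : V, G.ends (η e) = s(u, v) ∧ u ∈ B x ∧ v ∈ B y

/-- A homomorphism of signed graphs: after a suitable switching of the source,
a map of vertices and edges preserving incidences and signs. -/
def HomTo (G : SGraph V) (H : SGraph W) : Prop :=
  ∃ s : V → Bool, ∃ f : V → W, ∃ g : G.E → H.E,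
    ∀ (e : G.E) (u v : V), G.ends e = s(u, v) →
      H.ends (g e) = s(f u, f v) ∧ H.neg (g e) = (G.switch s).neg e

/-- A subdivision of `H` is isomorphic to a subgraph of `G` (signs ignored):
an injection of the vertices of `H` together with internally disjoint,
edge-disjoint paths of `G` realizing the edges of `H`. -/
def IsSubdivisionOf (H : SGraph W) (G : SGraph V) : Prop :=
  ∃ (φ : W → V) (ep : H.E → W × W),
    Function.Injective φ ∧
    (∀ e : H.E, H.ends e = s((ep e).1, (ep e).2)) ∧
    ∃ P : (e : H.E) → G.Walk (φ (ep e).1) (φ (ep e).2),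
      (∀ e, (P e).support.Nodup) ∧
      (∀ e f, e ≠ f → ∀ x ∈ (P e).inner, x ∉ (P f).support) ∧
      (∀ e, ∀ x ∈ (P e).inner, x ∉ Set.range φ) ∧
      (∀ e f, e ≠ f → ∀ g ∈ (P e).edges, g ∉ (P f).edges)

/-- `H` is a total topological minor of `G`: a subdivision of `H` occurs as a
subgraph of `G` in which the path representing each edge `e` of `H` has sign
exactly the sign of `e`. -/
def IsTotalTopMinor (H : SGraph W) (G : SGraph V) : Prop :=
  ∃ (φ : W → V) (ep : H.E → W × W),
    Function.Injective φ ∧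
    (∀ e : H.E, H.ends e = s((ep e).1, (ep e).2)) ∧
    ∃ P : (e : H.E) → G.Walk (φ (ep e).1) (φ (ep e).2),
      (∀ e, (P e).support.Nodup) ∧
      (∀ e f, e ≠ f → ∀ x ∈ (P e).inner, x ∉ (P f).support) ∧
      (∀ e, ∀ x ∈ (P e).inner, x ∉ Set.range φ) ∧
      (∀ e f, e ≠ f → ∀ g ∈ (P e).edges, g ∉ (P f).edges) ∧
      (∀ e, (P e).isNeg = H.neg e)

/-- `H` is a topological minor of `G`: some subdivision of `H` occurs as a subgraph
of `G` in which every cycle of `H` keeps its sign; equivalently, after a suitable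
switching of `H`, `H` is a total topological minor of `G`. -/
def IsTopMinor (H : SGraph W) (G : SGraph V) : Prop :=
  ∃ s : W → Bool, (H.switch s).IsTotalTopMinor G

end SGraph

open SGraph

/-- The signed graph `G̃` obtained from a graph `G` by replacing each edge by a
pair of parallel edges, one positive and one negative. -/
def SimpleGraph.tildeS {V : Type} (G : SimpleGraph V) : SGraph V where
  E := G.edgeSet × Bool
  ends e := (e.1 : Sym2 V)
  neg e := e.2

/-- The all-negative signed graph `(G, -)` on a graph `G`. -/
def SimpleGraph.allNeg {V : Type} (G : SimpleGraph V) : SGraph V where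
  E := G.edgeSet
  ends e := (e : Sym2 V)
  neg _ := true

/-- `K̃_k`: the signed graph on `k` vertices with a positive and a negative edge
between each pair of distinct vertices. -/
def tildeK (k : ℕ) : SGraph (Fin k) := (⊤ : SimpleGraph (Fin k)).tildeS

/-- `(K_k, -)`: the all-negative complete signed graph on `k` vertices. -/
def allNegK (k : ℕ) : SGraph (Fin k) := (⊤ : SimpleGraph (Fin k)).allNeg

/-- `K̃_k⁺`: as `K̃_k`, with in addition a positive loop at every vertex. -/
def tildeKplus (k : ℕ) : SGraph (Fin k) where
  E := ((⊤ : SimpleGraph (Fin k)).edgeSet × Bool) ⊕ Fin k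
  ends := Sum.elim (fun e => (e.1 : Sym2 (Fin k))) (fun i => s(i, i))
  neg := Sum.elim (fun e => e.2) (fun _ => false)

/-- `G` has a `K_k`-minor: `k` disjoint connected branch sets, pairwise joined by an edge. -/
def SimpleGraph.HasCliqueMinor {V : Type} (G : SimpleGraph V) (k : ℕ) : Prop :=
  ∃ T : Fin k → G.Subgraph,
    (∀ i, (T i).coe.Connected) ∧
    (Pairwise fun i j => Disjoint (T i).verts (T j).verts) ∧
    ∀ i j, i ≠ j → ∃ u v, G.Adj u v ∧ u ∈ (T i).verts ∧ v ∈ (T j).verts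

/-- `G` has an odd-`K_k`-minor: a 2-coloring of the vertices together with `k`
disjoint trees, all of whose edges are properly colored, pairwise joined by a
monochromatic edge. -/
def SimpleGraph.HasOddCliqueMinor {V : Type} (G : SimpleGraph V) (k : ℕ) : Prop :=
  ∃ c : V → Bool, ∃ T : Fin k → G.Subgraph,
    (∀ i, (T i).coe.IsTree) ∧
    (Pairwise fun i j => Disjoint (T i).verts (T j).verts) ∧
    (∀ i, ∀ u v, (T i).Adj u v → c u ≠ c v) ∧
    ∀ i j, i ≠ j →
      ∃ u v, G.Adj u v ∧ u ∈ (T i).verts ∧ v ∈ (T j).verts ∧ c u = c v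

/-- `G` has an even-odd-`K_k`-minor: as an odd-`K_k`-minor, with in addition a
properly colored edge between each pair of distinct trees. -/
def SimpleGraph.HasEvenOddCliqueMinor {V : Type} (G : SimpleGraph V) (k : ℕ) : Prop :=
  ∃ c : V → Bool, ∃ T : Fin k → G.Subgraph,
    (∀ i, (T i).coe.IsTree) ∧
    (Pairwise fun i j => Disjoint (T i).verts (T j).verts) ∧
    (∀ i, ∀ u v, (T i).Adj u v → c u ≠ c v) ∧
    ∀ i j, i ≠ j →
      (∃ u v, G.Adj u v ∧ u ∈ (T i).verts ∧ v ∈ (T j).verts ∧ c u = c v) ∧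
      (∃ u v, G.Adj u v ∧ u ∈ (T i).verts ∧ v ∈ (T j).verts ∧ c u ≠ c v)

/-- The fractional chromatic number of a finite graph: the infimum total weight of
a system of nonnegative weights on independent sets covering every vertex with
total weight at least 1. -/
noncomputable def SimpleGraph.fracChrom {V : Type} [Fintype V] [DecidableEq V]
    (G : SimpleGraph V) : ℝ :=
  sInf {r : ℝ | ∃ w : Finset V → ℝ, (∀ A, 0 ≤ w A) ∧
    (∀ A : Finset V, w A ≠ 0 → (∀ u ∈ A, ∀ v ∈ A, ¬G.Adj u v)) ∧
    (∀ v : V, 1 ≤ ∑ A : Finset V, if v ∈ A then w A else 0) ∧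
    ∑ A : Finset V, w A ≤ r}

/-- The fractional balanced chromatic number of a finite signed graph: the infimum
total weight of a system of nonnegative weights on balanced sets covering every
vertex with total weight at least 1. -/
noncomputable def SGraph.fracChromB {V : Type} [Fintype V] [DecidableEq V]
    (G : SGraph V) : ℝ :=
  sInf {r : ℝ | ∃ w : Finset V → ℝ, (∀ A, 0 ≤ w A) ∧
    (∀ A : Finset V, w A ≠ 0 → G.BalancedSet ↑A) ∧
    (∀ v : V, 1 ≤ ∑ A : Finset V, if v ∈ A then w A else 0) ∧
    ∑ A : Finset V, w A ≤ r}

section Aux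

variable {V : Type}

/-- One step along an edge inside `C` that is positive after switching at `s`. -/
def PStep (G : SGraph V) (s : V → Bool) (C : Set V) (x y : V) : Prop :=
  x ∈ C ∧ y ∈ C ∧ ∃ e, G.ends e = s(x, y) ∧ G.neg e = Bool.xor (s x) (s y)

/-- All edges inside `C` are positive after switching at `s`. -/
def Pot (G : SGraph V) (s : V → Bool) (C : Set V) : Prop :=
  ∀ e x y, G.ends e = s(x, y) → x ∈ C → y ∈ C → G.neg e = Bool.xor (s x) (s y)

/-- Connected via positive edges after switching at `s`. -/
def PConn (G : SGraph V) (s : V → Bool) (C : Set V) : Prop :=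
  ∀ x ∈ C, ∀ y ∈ C, Relation.ReflTransGen (PStep G s C) x y

theorem switch_neg_eq (G : SGraph V) (s : V → Bool) (e : G.E) (x y : V)
    (h : G.ends e = s(x, y)) :
    (G.switch s).neg e = Bool.xor (G.neg e) (Bool.xor (s x) (s y)) := by
  simp [SGraph.switch, h]

theorem walk_mem_start {G : SGraph V} {u v : V} (p : G.Walk u v) : u ∈ p.support := by
  cases p <;> simp [SGraph.Walk.support]

theorem walk_isNeg_of_pot (G : SGraph V) (s : V → Bool) (C : Set V) (h : Pot G s C)
    {u v : V} (p : G.Walk u v) (hp : ∀ x ∈ p.support, x ∈ C) :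
    p.isNeg = Bool.xor (s u) (s v) := by
  induction p with
  | nil => simp [SGraph.Walk.isNeg, SGraph.Walk.edges]
  | @cons u v w e he p ih =>
    have h1 : ∀ x ∈ p.support, x ∈ C := fun x hx => hp x (by simp [SGraph.Walk.support, hx])
    have h2 := ih h1
    have h3 := h e u v he (hp u (by simp [SGraph.Walk.support])) (h1 v (walk_mem_start p))
    have h4 : (SGraph.Walk.cons e he p).isNeg = Bool.xor (G.neg e) p.isNeg := by
      simp [SGraph.Walk.isNeg, SGraph.Walk.edges]
    rw [h4, h2, h3]
    cases s u <;> cases s v <;> cases s w <;> rfl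

theorem balanced_of_pot (G : SGraph V) (s : V → Bool) (C : Set V) (h : Pot G s C) :
    G.BalancedSet C := by
  intro v p _ hp
  rw [walk_isNeg_of_pot G s C h p hp]
  simp

theorem walk_of_reach (G : SGraph V) (s : V → Bool) (C : Set V) {u v : V} (hv : v ∈ C)
    (h : Relation.ReflTransGen (PStep G s C) u v) :
    ∃ p : (G.switch s).Walk u v,
      (∀ x ∈ p.support, x ∈ C) ∧ ∀ e ∈ p.edges, (G.switch s).neg e = false := by
  induction h using Relation.ReflTransGen.head_induction_on with
  | refl => exact ⟨.nil, by simp [SGraph.Walk.support, hv], by simp [SGraph.Walk.edges]⟩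
  | @head a b hab _ ih =>
    obtain ⟨p, hp1, hp2⟩ := ih
    obtain ⟨ha, hb, e, he, hn⟩ := hab
    refine ⟨.cons e he p, ?_, ?_⟩
    · intro x hx
      simp only [SGraph.Walk.support, List.mem_cons] at hx
      rcases hx with rfl | hx
      · exact ha
      · exact hp1 x hx
    · intro x hx
      have hx : x = e ∨ x ∈ p.edges := List.mem_cons.1 hx
      rcases hx with rfl | hx
      · rw [switch_neg_eq G s _ _ _ he, hn]; simp
      · exact hp2 x hx

theorem pstep_symm (G : SGraph V) (s : V → Bool) (C : Set V) {x y : V}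
    (h : PStep G s C x y) : PStep G s C y x := by
  obtain ⟨hx, hy, e, he, hn⟩ := h
  exact ⟨hy, hx, e, by rw [he, Sym2.eq_swap], by rw [hn, Bool.xor_comm]⟩

theorem pstep_congr (G : SGraph V) {s s' : V → Bool} {C C' : Set V} (hC : C ⊆ C')
    (hs : ∀ x ∈ C, s x = s' x) {x y : V}
    (h : PStep G s C x y) : PStep G s' C' x y := by
  obtain ⟨hx, hy, e, he, hn⟩ := h
  exact ⟨hC hx, hC hy, e, he, by rw [hn, hs x hx, hs y hy]⟩

theorem pot_congr (G : SGraph V) {s s' : V → Bool} {C : Set V}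
    (hs : ∀ x ∈ C, s x = s' x) (h : Pot G s C) : Pot G s' C := by
  intro e x y he hx hy
  rw [h e x y he hx hy, hs x hx, hs y hy]

theorem pconn_congr (G : SGraph V) {s s' : V → Bool} {C : Set V}
    (hs : ∀ x ∈ C, s x = s' x) (h : PConn G s C) : PConn G s' C := by
  intro x hx y hy
  exact (h x hx y hy).lift id fun a b hab => pstep_congr G (le_refl C) hs hab

/-- Extending a balanced connected set by a vertex all of whose edges to it have the same
switched sign. -/
theorem extend_good [DecidableEq V] (G : SGraph V) (hloop : ∀ e v, G.ends e = s(v, v) → G.neg e = false)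
    (s : V → Bool) (B : Set V) (h1 : Pot G s B) (h2 : PConn G s B) (u v : V) (hu : u ∈ B)
    (hv : v ∉ B) (e : G.E) (he : G.ends e = s(u, v)) (c : Bool)
    (hc : ∀ e' u', G.ends e' = s(u', v) → u' ∈ B → Bool.xor (G.neg e') (s u') = c) :
    ∃ s', Pot G s' (insert v B) ∧ PConn G s' (insert v B) := by
  have hs : ∀ x ∈ B, s x = Function.update s v c x := by
    intro x hx
    rw [Function.update_of_ne]
    rintro rfl
    exact hv hx
  have key : ∀ e' u', G.ends e' = s(u', v) → u' ∈ B →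
      G.neg e' = Bool.xor (Function.update s v c u') (Function.update s v c v) := by
    intro e' u' he' hu'
    rw [← hs u' hu', Function.update_self, ← hc e' u' he' hu']
    cases G.neg e' <;> cases s u' <;> rfl
  refine ⟨Function.update s v c, ?_, ?_⟩
  · intro e' x y he' hx hy
    rcases hx with rfl | hx
    · rcases hy with rfl | hy
      · rw [hloop e' _ he']; simp
      · rw [Bool.xor_comm]; exact key e' y (by rw [he', Sym2.eq_swap]) hy
    · rcases hy with rfl | hy
      · exact key e' x he' hx
      · exact pot_congr G hs h1 e' x y he' hx hy
  · have hst : PStep G (Function.update s v c) (insert v B) u v :=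
      ⟨Or.inr hu, Or.inl rfl, e, he, key e u he hu⟩
    have hin : ∀ x ∈ B, ∀ y ∈ B,
        Relation.ReflTransGen (PStep G (Function.update s v c) (insert v B)) x y := by
      intro x hx y hy
      exact (h2 x hx y hy).lift id fun a b hab => pstep_congr G (Set.subset_insert v B) hs hab
    intro x hx y hy
    rcases hx with rfl | hx
    · rcases hy with rfl | hy
      · exact .refl
      · exact .head (pstep_symm G _ _ hst) (hin u hu y hy)
    · rcases hy with rfl | hy
      · exact (hin x hx u hu).tail hst
      · exact hin x hx y hy

/-- The greedy decomposition. -/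
theorem decomp [DecidableEq V] (G : SGraph V)
    (hloop : ∀ e v, G.ends e = s(v, v) → G.neg e = false) (n : ℕ) :
    ∀ R : Finset V, R.card = n → ∃ (k : ℕ) (f : V → ℕ) (s : V → Bool),
      (∀ v ∈ R, f v < k) ∧ (∀ i < k, ∃ v ∈ R, f v = i) ∧
      (∀ i < k, Pot G s {v | v ∈ R ∧ f v = i} ∧ PConn G s {v | v ∈ R ∧ f v = i}) ∧
      (∀ e u v, G.ends e = s(u, v) → u ∈ R → v ∈ R → f u ≠ f v → ∀ b : Bool,
        ∃ e' u' v', G.ends e' = s(u', v') ∧ u' ∈ R ∧ v' ∈ R ∧ f u' = f u ∧ f v' = f v ∧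
          Bool.xor (G.neg e') (Bool.xor (s u') (s v')) = b) := by
  classical
  induction n using Nat.strong_induction_on with
  | _ n ih =>
  intro R hR
  rcases R.eq_empty_or_nonempty with rfl | ⟨a, ha⟩
  · exact ⟨0, fun _ => 0, fun _ => false, by simp, by simp, by simp, by simp⟩
  -- the family of good sets
  let F : Finset (Finset V) := R.powerset.filter fun B =>
    B.Nonempty ∧ ∃ s, Pot G s (B : Set V) ∧ PConn G s (B : Set V)
  have hF : F.Nonempty := by
    refine ⟨{a}, ?_⟩
    simp only [F, Finset.mem_filter, Finset.mem_powerset, Finset.singleton_subset_iff]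
    refine ⟨ha, Finset.singleton_nonempty a, fun _ => false, ?_, ?_⟩
    · intro e x y he hx hy
      simp only [Finset.coe_singleton, Set.mem_singleton_iff] at hx hy
      subst hx; subst hy
      rw [hloop e _ he]; simp
    · intro x hx y hy
      simp only [Finset.coe_singleton, Set.mem_singleton_iff] at hx hy
      subst hx; subst hy
      exact .refl
  obtain ⟨B, hBF, hBmax⟩ := F.exists_max_image Finset.card hF
  simp only [F, Finset.mem_filter, Finset.mem_powerset] at hBF
  obtain ⟨hBR, hBne, sB, hpot, hconn⟩ := hBF
  have hlt : (R \ B).card < n := by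
    rw [← hR]
    obtain ⟨b, hb⟩ := hBne
    exact Finset.card_lt_card (Finset.ssubset_iff_subset_ne.2 ⟨Finset.sdiff_subset, fun h => by
      have := hBR hb
      rw [← h] at this
      simp [hb] at this⟩)
  obtain ⟨k, f, s, h1, h2, h3, h4⟩ := ih _ hlt (R \ B) rfl
  -- edges between `B` and the rest come in both signs
  have both : ∀ e u v, G.ends e = s(u, v) → u ∈ B → v ∈ R → v ∉ B → ∀ c : Bool,
      ∃ e' u', G.ends e' = s(u', v) ∧ u' ∈ B ∧ Bool.xor (G.neg e') (sB u') = c := by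
    intro e u v he hu hv hvB c
    by_contra hcon
    push Not at hcon
    obtain ⟨s', hs1, hs2⟩ := extend_good G hloop sB B hpot hconn u v hu hvB e he (!c) (by
      intro e' u' he' hu'
      have := hcon e' u' he' hu'
      revert this
      cases (G.neg e' ^^ sB u') <;> cases c <;> simp)
    have hmem : insert v B ∈ F := by
      simp only [F, Finset.mem_filter, Finset.mem_powerset]
      refine ⟨Finset.insert_subset hv hBR, Finset.insert_nonempty _ _, s', ?_⟩
      rw [Finset.coe_insert]
      exact ⟨hs1, hs2⟩
    have := hBmax _ hmem
    rw [Finset.card_insert_of_notMem hvB] at this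
    omega
  let f' : V → ℕ := fun v => if v ∈ B then k else f v
  let s' : V → Bool := fun v => if v ∈ B then sB v else s v
  have hfB : ∀ v ∈ B, f' v = k := fun v hv => by simp [f', hv]
  have hfN : ∀ v, v ∉ B → f' v = f v := fun v hv => by simp [f', hv]
  have hsB : ∀ v ∈ B, s' v = sB v := fun v hv => by simp [s', hv]
  have hsN : ∀ v, v ∉ B → s' v = s v := fun v hv => by simp [s', hv]
  have hlow : ∀ v ∈ R, v ∉ B → f v < k := fun v hv hvB => h1 v (Finset.mem_sdiff.2 ⟨hv, hvB⟩)
  -- both signs, in the glued switching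
  have both' : ∀ e u v, G.ends e = s(u, v) → u ∈ B → v ∈ R → v ∉ B → ∀ b : Bool,
      ∃ e' u', G.ends e' = s(u', v) ∧ u' ∈ B ∧
        Bool.xor (G.neg e') (Bool.xor (s' u') (s' v)) = b := by
    intro e u v he hu hv hvB b
    obtain ⟨e', u', he', hu', hx⟩ := both e u v he hu hv hvB (Bool.xor b (s' v))
    refine ⟨e', u', he', hu', ?_⟩
    rw [hsB u' hu', ← Bool.xor_assoc, hx]
    simp
  refine ⟨k + 1, f', s', ?_, ?_, ?_, ?_⟩
  · intro v hv
    by_cases hvB : v ∈ B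
    · rw [hfB v hvB]; omega
    · rw [hfN v hvB]; have := hlow v hv hvB; omega
  · intro i hi
    rcases Nat.lt_succ_iff_lt_or_eq.1 hi with hi | rfl
    · obtain ⟨v, hv, hvi⟩ := h2 i hi
      rw [Finset.mem_sdiff] at hv
      exact ⟨v, hv.1, by rw [hfN v hv.2, hvi]⟩
    · obtain ⟨b, hb⟩ := hBne
      exact ⟨b, hBR hb, hfB b hb⟩
  · intro i hi
    rcases Nat.lt_succ_iff_lt_or_eq.1 hi with hi | rfl
    · have hset : {v | v ∈ R ∧ f' v = i} = {v | v ∈ R \ B ∧ f v = i} := by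
        ext v
        simp only [Set.mem_ofPred_eq, Finset.mem_sdiff]
        by_cases hvB : v ∈ B
        · simp only [hfB v hvB, hvB]
          constructor
          · rintro ⟨_, h⟩; omega
          · rintro ⟨⟨_, h⟩, _⟩; exact absurd trivial h
        · simp [hfN v hvB, hvB]
      have hss : ∀ x ∈ {v | v ∈ R \ B ∧ f v = i}, s x = s' x := by
        intro x hx
        exact (hsN x (Finset.mem_sdiff.1 hx.1).2).symm
      rw [hset]
      exact ⟨pot_congr G hss (h3 i hi).1, pconn_congr G hss (h3 i hi).2⟩
    · have hset : {v | v ∈ R ∧ f' v = i} = (B : Set V) := by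
        ext v
        simp only [Set.mem_ofPred_eq, Finset.mem_coe]
        constructor
        · rintro ⟨hv, hvi⟩
          by_contra hvB
          rw [hfN v hvB] at hvi
          have := hlow v hv hvB
          omega
        · intro hv; exact ⟨hBR hv, hfB v hv⟩
      have hss : ∀ x ∈ (B : Set V), sB x = s' x := fun x hx => (hsB x hx).symm
      rw [hset]
      exact ⟨pot_congr G hss hpot, pconn_congr G hss hconn⟩
  · intro e u v he hu hv hne b
    by_cases huB : u ∈ B
    · by_cases hvB : v ∈ B
      · rw [hfB u huB, hfB v hvB] at hne; exact absurd rfl hne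
      · obtain ⟨e', u', he', hu', hx⟩ := both' e u v he huB hv hvB b
        exact ⟨e', u', v, he', hBR hu', hv, by rw [hfB u huB, hfB u' hu'], rfl, hx⟩
    · by_cases hvB : v ∈ B
      · obtain ⟨e', v', he', hv', hx⟩ := both' e v u (by rw [he, Sym2.eq_swap]) hvB hu huB b
        exact ⟨e', u, v', by rw [he', Sym2.eq_swap], hu, hBR hv', rfl,
          by rw [hfB v hvB, hfB v' hv'], by rw [Bool.xor_comm (s' u)]; exact hx⟩
      · rw [hfN u huB, hfN v hvB] at hne
        obtain ⟨e', u', v', he', hu', hv', hfu, hfv, hx⟩ :=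
          h4 e u v he (Finset.mem_sdiff.2 ⟨hu, huB⟩) (Finset.mem_sdiff.2 ⟨hv, hvB⟩) hne b
        rw [Finset.mem_sdiff] at hu' hv'
        refine ⟨e', u', v', he', hu'.1, hv'.1, ?_, ?_, ?_⟩
        · rw [hfN u huB, hfN u' hu'.2, hfu]
        · rw [hfN v hvB, hfN v' hv'.2, hfv]
        · rw [hsN u' hu'.2, hsN v' hv'.2]; exact hx

/-- The quotient graph. -/
def quotG {k : ℕ} (G : SGraph V) (f : V → Fin k) : SimpleGraph (Fin k) where
  Adj i j := i ≠ j ∧ ∃ e u v, G.ends e = s(u, v) ∧ f u = i ∧ f v = j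
  symm := ⟨by
    rintro i j ⟨hij, e, u, v, he, hu, hv⟩
    exact ⟨hij.symm, e, v, u, by rw [he, Sym2.eq_swap], hv, hu⟩⟩
  loopless := ⟨fun i h => h.1 rfl⟩

theorem minor_lift {k t : ℕ} (G : SGraph V) (f : V → Fin k) (s : V → Bool)
    (hsurj : Function.Surjective f)
    (hconn : ∀ i, PConn G s {v | f v = i})
    (hboth : ∀ i j, (quotG G f).Adj i j → ∀ b : Bool, ∃ e u v, G.ends e = s(u, v) ∧
      f u = i ∧ f v = j ∧ Bool.xor (G.neg e) (Bool.xor (s u) (s v)) = b)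
    (hm : (quotG G f).HasCliqueMinor t) : (tildeK t).IsMinor G := by
  classical
  obtain ⟨T, hT1, hT2, hT3⟩ := hm
  have hdisj : ∀ x y v, f v ∈ (T x).verts → f v ∈ (T y).verts → x = y := by
    intro x y v hx hy
    by_contra hne
    exact Set.disjoint_left.1 (hT2 hne) hx hy
  have hfib : ∀ x i, i ∈ (T x).verts → ∀ u v, f u = i → f v = i →
      Relation.ReflTransGen (PStep G s {v | f v ∈ (T x).verts}) u v := by
    intro x i hi u v hu hv
    exact (hconn i u hu v hv).lift id fun a b hab => pstep_congr G
      (fun w (hw : f w = i) => by simpa [hw] using hi) (fun _ _ => rfl) hab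
  have hwalk : ∀ x (i j : (T x).verts), (T x).coe.Walk i j → ∀ u v, f u = i → f v = j →
      Relation.ReflTransGen (PStep G s {v | f v ∈ (T x).verts}) u v := by
    intro x i j p
    induction p with
    | nil => intro u v hu hv; exact hfib x _ (Subtype.property _) u v hu hv
    | @cons i l j hil p ih =>
      intro u v hu hv
      have hadj : (quotG G f).Adj i l := (T x).adj_sub hil
      obtain ⟨e, a, b, he, ha, hb, hx⟩ := hboth i l hadj false
      refine (hfib x i i.2 u a hu ha).trans (.head ?_ (ih b v hb hv))
      refine ⟨by simp [ha], by simp [hb], e, he, ?_⟩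
      revert hx
      cases G.neg e <;> cases (s a ^^ s b) <;> simp
  have hedge : ∀ e : (tildeK t).E, ∃ (e' : G.E) (x y : Fin t) (u v : V),
      (tildeK t).ends e = s(x, y) ∧ G.ends e' = s(u, v) ∧ f u ∈ (T x).verts ∧
      f v ∈ (T y).verts ∧ (G.switch s).neg e' = (tildeK t).neg e := by
    rintro ⟨⟨e, he⟩, b⟩
    induction e using Sym2.ind with
    | _ x y =>
    have hxy : x ≠ y := by simpa using he
    obtain ⟨i, j, hij, hi, hj⟩ := hT3 x y hxy
    obtain ⟨e', u, v, he', hu, hv, hb⟩ := hboth i j hij b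
    refine ⟨e', x, y, u, v, rfl, he', by rwa [hu], by rwa [hv], ?_⟩
    rw [switch_neg_eq G s e' u v he', hb]
    rfl
  choose η X Y U W hη1 hη2 hη3 hη4 hη5 using hedge
  refine ⟨s, fun x => {v | f v ∈ (T x).verts}, ?_, ?_, η, ?_, ?_⟩
  · intro x
    refine ⟨?_, ?_⟩
    · obtain ⟨i⟩ := (hT1 x).nonempty
      obtain ⟨v, hv⟩ := hsurj i
      exact ⟨v, by simp [hv]⟩
    · intro u hu v hv
      obtain ⟨p⟩ := (hT1 x).preconnected ⟨f u, hu⟩ ⟨f v, hv⟩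
      exact walk_of_reach G s _ hv (hwalk x _ _ p u v rfl rfl)
  · intro x y hxy
    exact Set.disjoint_left.2 fun v hx hy => hxy (hdisj x y v hx hy)
  · intro e e' hee
    have hb : (tildeK t).neg e = (tildeK t).neg e' := by rw [← hη5, ← hη5, hee]
    have hends : (tildeK t).ends e = (tildeK t).ends e' := by
      have h1 := hη2 e
      rw [hee, hη2 e'] at h1
      rw [hη1 e, hη1 e']
      rcases Sym2.eq_iff.1 h1 with ⟨hu, hw⟩ | ⟨hu, hw⟩
      · have a1 := hη3 e; have a2 := hη4 e
        rw [← hu] at a1; rw [← hw] at a2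
        rw [hdisj _ _ _ a1 (hη3 e'), hdisj _ _ _ a2 (hη4 e')]
      · have a1 := hη3 e; have a2 := hη4 e
        rw [← hw] at a1; rw [← hu] at a2
        rw [hdisj _ _ _ a1 (hη4 e'), hdisj _ _ _ a2 (hη3 e'), Sym2.eq_swap]
    exact Prod.ext (Subtype.ext hends) hb
  · intro e x y hxy
    refine ⟨hη5 e, ?_⟩
    have h1 := hη1 e
    rw [hxy] at h1
    rcases Sym2.eq_iff.1 h1 with ⟨rfl, rfl⟩ | ⟨rfl, rfl⟩
    · exact ⟨U e, W e, hη2 e, hη3 e, hη4 e⟩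
    · exact ⟨W e, U e, by rw [hη2 e, Sym2.eq_swap], hη4 e, hη3 e⟩

theorem frac_lift {k : ℕ} [Fintype V] [DecidableEq V] (G : SGraph V) (f : V → Fin k)
    (s : V → Bool) (hpot : ∀ i, Pot G s {v | f v = i}) :
    G.fracChromB ≤ (quotG G f).fracChrom := by
  classical
  apply csInf_le_csInf
  · refine ⟨0, ?_⟩
    rintro r ⟨w, hw, _, _, hr⟩
    exact (Finset.sum_nonneg fun A _ => hw A).trans hr
  · refine ⟨_, fun A => if A.card = 1 then 1 else 0, ?_, ?_, ?_, le_refl _⟩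
    · intro A; dsimp only; split_ifs <;> norm_num
    · intro A hA u hu v hv huv
      have hA1 : A.card = 1 := by by_contra h; simp [h] at hA
      obtain ⟨a, rfl⟩ := Finset.card_eq_one.1 hA1
      rw [Finset.mem_singleton] at hu hv
      subst hu; subst hv
      exact huv.1 rfl
    · intro v
      refine le_trans (by simp) (Finset.single_le_sum
        (f := fun A : Finset (Fin k) => if v ∈ A then (if A.card = 1 then (1 : ℝ) else 0) else 0)
        (fun A _ => by split_ifs <;> norm_num) (Finset.mem_univ {v}))
  · rintro r ⟨w, hw0, hwi, hwc, hwr⟩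
    let pre : Finset (Fin k) → Finset V := fun C => Finset.univ.filter fun v => f v ∈ C
    refine ⟨fun A => ∑ C, if pre C = A then w C else 0, ?_, ?_, ?_, ?_⟩
    · intro A
      exact Finset.sum_nonneg fun C _ => by split_ifs; exacts [hw0 C, le_refl _]
    · intro A hA
      obtain ⟨C, _, hC⟩ := Finset.exists_ne_zero_of_sum_ne_zero hA
      have hCA : pre C = A := by by_contra h; simp [h] at hC
      rw [if_pos hCA] at hC
      apply balanced_of_pot G s
      intro e x y he hx hy
      rw [← hCA] at hx hy
      simp only [pre, Finset.coe_filter, Finset.mem_univ, true_and, Set.mem_ofPred_eq] at hx hy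
      have hxy : f x = f y := by
        by_contra hne
        exact hwi C hC _ hx _ hy ⟨hne, e, x, y, he, rfl, rfl⟩
      exact hpot (f y) e x y he hxy rfl
    · intro v
      refine (hwc (f v)).trans (le_of_eq ?_)
      have : ∀ A : Finset V, (if v ∈ A then ∑ C, (if pre C = A then w C else 0) else 0)
          = ∑ C, if pre C = A then (if v ∈ A then w C else 0) else 0 := by
        intro A
        by_cases h : v ∈ A <;> simp [h]
      rw [Finset.sum_congr rfl fun A _ => this A, Finset.sum_comm]
      refine Finset.sum_congr rfl fun C _ => ?_
      rw [Finset.sum_ite_eq]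
      simp [pre]
    · rw [Finset.sum_comm]
      simpa using hwr

theorem negloop_case [Fintype V] [DecidableEq V] (G : SGraph V) (e : G.E) (v : V)
    (he : G.ends e = s(v, v)) (hn : G.neg e = true) : G.fracChromB = 0 := by
  have : {r : ℝ | ∃ w : Finset V → ℝ, (∀ A, 0 ≤ w A) ∧
    (∀ A : Finset V, w A ≠ 0 → G.BalancedSet ↑A) ∧
    (∀ v : V, 1 ≤ ∑ A : Finset V, if v ∈ A then w A else 0) ∧
    ∑ A : Finset V, w A ≤ r} = ∅ := by
    ext r
    simp only [Set.mem_ofPred_eq, Set.mem_empty_iff_false, iff_false]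
    rintro ⟨w, _, hb, hc, _⟩
    have h0 : ∑ A : Finset V, (if v ∈ A then w A else 0) = 0 := by
      refine Finset.sum_eq_zero fun A _ => ?_
      split_ifs with hv
      · by_contra hA
        have := hb A hA v (.cons e he .nil)
          (by simp [SGraph.Walk.IsCycle, SGraph.Walk.edges, SGraph.Walk.support])
          (by simp [SGraph.Walk.support, hv])
        simp [SGraph.Walk.isNeg, SGraph.Walk.edges, hn] at this
      · rfl
    have := hc v
    rw [h0] at this
    norm_num at this
  unfold SGraph.fracChromB
  rw [this, Real.sInf_empty]

end Aux


/-- if every `K_t`-minor-free graph has fractional chromatic number at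
most `2t - 2`, then every signed graph with no `K̃_t`-minor has fractional balanced
chromatic number at most `2t - 2`. -/
theorem stmt18 (t : ℕ)
    (h : ∀ (m : ℕ) (G : SimpleGraph (Fin m)), ¬ G.HasCliqueMinor t →
      G.fracChrom ≤ 2 * (t : ℝ) - 2) :
    ∀ (m : ℕ) (G : SGraph (Fin m)), ¬ (tildeK t).IsMinor G →
      G.fracChromB ≤ 2 * (t : ℝ) - 2 := by
  intro m G hG
  by_cases hloop : ∀ e v, G.ends e = s(v, v) → G.neg e = false
  · obtain ⟨k, f, s, h1, h2, h3, h4⟩ := decomp G hloop _ Finset.univ rfl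
    let g : Fin m → Fin k := fun v => ⟨f v, h1 v (Finset.mem_univ v)⟩
    have hset : ∀ i : Fin k, {v | g v = i} = {v | v ∈ Finset.univ ∧ f v = i} := by
      intro i
      ext v
      simp [g, Fin.ext_iff]
    refine (frac_lift G g s fun i => ?_).trans (h k _ fun hm => hG ?_)
    · rw [hset]; exact (h3 i i.2).1
    · refine minor_lift G g s ?_ ?_ ?_ hm
      · intro i
        obtain ⟨v, _, hv⟩ := h2 i i.2
        exact ⟨v, Fin.ext hv⟩
      · intro i
        rw [hset]; exact (h3 i i.2).2
      · rintro i j ⟨hij, e, u, v, he, rfl, rfl⟩ b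
        obtain ⟨e', u', v', he', _, _, hu, hv, hx⟩ := h4 e u v he (Finset.mem_univ _)
          (Finset.mem_univ _) (fun hh => hij (Fin.ext hh)) b
        exact ⟨e', u', v', he', Fin.ext hu, Fin.ext hv, hx⟩
  · push Not at hloop
    obtain ⟨e, v, he, hn⟩ := hloop
    rw [negloop_case G e v he (by simpa using hn)]
    have ht : t ≠ 0 := by
      rintro rfl
      refine hG ⟨fun _ => false, fun x => x.elim0, fun x => x.elim0, fun x => x.elim0,
        fun e => (Quot.out e.1.1).1.elim0, fun e => (Quot.out e.1.1).1.elim0,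
        fun e x => x.elim0⟩
    have : (1 : ℝ) ≤ t := by exact_mod_cast Nat.one_le_iff_ne_zero.2 ht
    linarith
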